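/- Let b = 3 and J = {(0,0),(2,0),(0,2)}, so γ = log #J / log b = 1. Let (n_j)_{j∈ℕ} be a strictly increasing sequence of positive integers with n_1 = 1 and n_{j+1}/n_j → ∞, and let (z,w) ∈ Λ be the point whose digit sequence satisfies (z_i,w_i) = (0,0) whenever n_j ≤ i < n_{j+1} with j odd, and (z_i,w_i) = (0,2) whenever n_j ≤ i < n_{j+1} with j even. Suppose λ(n)/n → λ and ξ(n)/n → ξ as n → ∞, with ξ > λ > 0. Then dim_H(Λ ∩ {(x,y) ∈ [0,1]² : y = w}) = 0, while dim_H Λ_{λ,ξ}(z,w) = min{ 1/(1+λ), (1 + (ξ−λ)·log 2/log 3)/(1+ξ) } > 1/(1+ξ). In particular, dim_H Λ_{λ,ξ}(z,w) is strictly larger than min{ γ/(1+λ), (γ + (ξ−λ)·dim_H(Λ ∩ {y = w}))/(1+ξ) }, so the dimension formula of the special-case theorem fails without the assumption that the digit frequencies p_a(z,w) exist. -/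

import Mathlib

open Set Filter Topology MeasureTheory
open scoped ENNReal NNReal Topology

noncomputable section

namespace ShrinkingRect

/-- The real number with 1-indexed base-`b` digit sequence `u` (digit `i` is `u i` for `i ≥ 1`). -/
def val (b : ℕ) (u : ℕ → ℕ) : ℝ := ∑' i : ℕ, (u (i + 1) : ℝ) / (b : ℝ) ^ (i + 1)

/-- The self-similar carpet `Λ` with digit set `J ⊆ {0,…,b−1}²`. -/
def carpet (b : ℕ) (J : Finset (ℕ × ℕ)) : Set (ℝ × ℝ) :=
  {p | ∃ d : ℕ → ℕ × ℕ, (∀ i, 1 ≤ i → d i ∈ J) ∧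
    p = (val b (fun i => (d i).1), val b (fun i => (d i).2))}

/-- `J₂(a)`: the digits of `J` lying in row `a`. -/
def J2 (J : Finset (ℕ × ℕ)) (a : ℕ) : Finset (ℕ × ℕ) := J.filter fun p => p.2 = a

/-- The contraction `f_{u,v}(x,y) = ((x+u)/b, (y+v)/b)`. -/
def fmap (b : ℕ) (uv : ℕ × ℕ) (p : ℝ × ℝ) : ℝ × ℝ :=
  ((p.1 + (uv.1 : ℝ)) / b, (p.2 + (uv.2 : ℝ)) / b)

/-- `f_t = f_{u₁,v₁} ∘ ⋯ ∘ f_{uₙ,vₙ}` for a finite word `t = ((u₁,v₁),…,(uₙ,vₙ))`. -/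
def fword (b : ℕ) (t : List (ℕ × ℕ)) (p : ℝ × ℝ) : ℝ × ℝ :=
  t.foldr (fmap b) p

/-- The limsup set `W_{λ,ξ}(z,w)`. -/
def Wset (b : ℕ) (J : Finset (ℕ × ℕ)) (lam xi : ℕ → ℕ) (z w : ℝ) : Set (ℝ × ℝ) :=
  {p | p ∈ carpet b J ∧
    {t : List (ℕ × ℕ) | t ≠ [] ∧ (∀ e ∈ t, e ∈ J) ∧
      |p.1 - (fword b t (z, w)).1| ≤ (b : ℝ) ^ (-(lam t.length : ℤ) - (t.length : ℤ)) ∧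
      |p.2 - (fword b t (z, w)).2| ≤ (b : ℝ) ^ (-(xi t.length : ℤ) - (t.length : ℤ))}.Infinite}

/-- The closeness condition (in one coordinate) defining `M_n(z,w)`:
`xd` is the digit string of the point, `zd` that of the centre, `L` is `λ(n)` or `ξ(n)`. -/
def closeCond (b L n : ℕ) (zd xd : ℕ → ℕ) : Prop :=
  (∀ i, 1 ≤ i → i < L → xd (i + n) = zd i) ∨
  (∃ j, 1 ≤ j ∧ j < L ∧ (∀ i, 1 ≤ i → i ≤ j - 1 → xd (i + n) = zd i) ∧
    (((xd (j + n) : ℤ) - (zd j : ℤ) = -1 ∧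
        ∀ i, j + 1 ≤ i → i < L → (xd (i + n) : ℤ) - (zd i : ℤ) = (b : ℤ) - 1) ∨
     ((xd (j + n) : ℤ) - (zd j : ℤ) = 1 ∧
        ∀ i, j + 1 ≤ i → i < L → (zd i : ℤ) - (xd (i + n) : ℤ) = (b : ℤ) - 1)))

/-- A choice of representative digit sequences for the points of the carpet: each point of `Λ`
gets a digit sequence in `J` representing it, whose partial products of row cardinalities
`∏ #J₂(y_i)` are eventually maximal among all representations of that point. -/
structure RepMap (b : ℕ) (J : Finset (ℕ × ℕ)) where
  rep : ℝ × ℝ → ℕ → ℕ × ℕ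
  mem_J : ∀ p ∈ carpet b J, ∀ i, 1 ≤ i → rep p i ∈ J
  eq_val : ∀ p ∈ carpet b J,
    p = (val b (fun i => (rep p i).1), val b (fun i => (rep p i).2))
  maximal : ∀ p ∈ carpet b J, ∀ d : ℕ → ℕ × ℕ, (∀ i, 1 ≤ i → d i ∈ J) →
    p = (val b (fun i => (d i).1), val b (fun i => (d i).2)) →
    ∃ N₀ : ℕ, ∀ N, N₀ ≤ N →
      ∏ i ∈ Finset.Icc 1 N, (J2 J (d i).2).card ≤
        ∏ i ∈ Finset.Icc 1 N, (J2 J (rep p i).2).card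

/-- The expanding map `T(x,y) = (bx − x₁, by − y₁)`, where `(x_i,y_i)` is the representative
digit sequence of `(x,y)`. -/
def Tmap {b : ℕ} {J : Finset (ℕ × ℕ)} (R : RepMap b J) (p : ℝ × ℝ) : ℝ × ℝ :=
  ((b : ℝ) * p.1 - ((R.rep p 1).1 : ℝ), (b : ℝ) * p.2 - ((R.rep p 1).2 : ℝ))

/-- The shrinking target set `Λ_{λ,ξ}(z,w)`. -/
def targetSet {b : ℕ} {J : Finset (ℕ × ℕ)} (R : RepMap b J) (lam xi : ℕ → ℕ)
    (z w : ℝ) : Set (ℝ × ℝ) :=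
  {p | p ∈ carpet b J ∧ ∃ᶠ n in atTop,
    ((Tmap R)^[n] p).1 ∈ Icc (z - (b : ℝ) ^ (-(lam n : ℤ))) (z + (b : ℝ) ^ (-(lam n : ℤ))) ∧
    ((Tmap R)^[n] p).2 ∈ Icc (w - (b : ℝ) ^ (-(xi n : ℤ))) (w + (b : ℝ) ^ (-(xi n : ℤ)))}

/-- The set `M_n(z,w)` (as a set of points of `Λ`, via representative sequences). -/
def Mset {b : ℕ} {J : Finset (ℕ × ℕ)} (R : RepMap b J) (lam xi : ℕ → ℕ)
    (zw : ℝ × ℝ) (n : ℕ) : Set (ℝ × ℝ) :=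
  {p | p ∈ carpet b J ∧
    closeCond b (lam n) n (fun i => (R.rep zw i).1) (fun i => (R.rep p i).1) ∧
    closeCond b (xi n) n (fun i => (R.rep zw i).2) (fun i => (R.rep p i).2)}

/-- `p_{n,j}(a,y) = #{λ(n) ≤ i ≤ j : y_{i+n} = a}`. -/
def pcount {b : ℕ} {J : Finset (ℕ × ℕ)} (R : RepMap b J) (lam : ℕ → ℕ)
    (p : ℝ × ℝ) (a n j : ℕ) : ℕ :=
  ((Finset.Icc (lam n) j).filter fun i => (R.rep p (i + n)).2 = a).card

/-- `A_{n,j}(z,w) = max_{(x,y) ∈ M_n(z,w)} Σ_a p_{n,j}(a,y) log #J₂(a)`. -/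
def Aval {b : ℕ} {J : Finset (ℕ × ℕ)} (R : RepMap b J) (lam xi : ℕ → ℕ)
    (zw : ℝ × ℝ) (n j : ℕ) : ℝ :=
  sSup ((fun p => ∑ a ∈ Finset.range b,
    (pcount R lam p a n j : ℝ) * Real.log ((J2 J a).card)) '' Mset R lam xi zw n)

/-- `s_n = min{ (n log #J + A_{n,j}(z,w)) / ((n+j) log b) : λ(n) ≤ j ≤ ξ(n) }`. -/
def sval {b : ℕ} {J : Finset (ℕ × ℕ)} (R : RepMap b J) (lam xi : ℕ → ℕ)
    (zw : ℝ × ℝ) (n : ℕ) : ℝ :=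
  sInf ((fun j : ℕ => ((n : ℝ) * Real.log J.card + Aval R lam xi zw n j) /
    (((n : ℝ) + (j : ℝ)) * Real.log b)) '' Set.Icc (lam n) (xi n))

/-- `#{1 ≤ i ≤ n : u i = a}`. -/
def freqCount (u : ℕ → ℕ) (a n : ℕ) : ℕ := ((Finset.Icc 1 n).filter fun i => u i = a).card

/-- The second-coordinate digit string of the representative sequence of a point. -/
def wdig {b : ℕ} {J : Finset (ℕ × ℕ)} (R : RepMap b J) (zw : ℝ × ℝ) (i : ℕ) : ℕ :=
  (R.rep zw i).2

/-- All digits with index at least `1` are `0` or `2`. -/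
def CantorDigits (u : ℕ → ℕ) : Prop := ∀ i, 1 ≤ i → u i = 0 ∨ u i = 2

theorem CantorDigits.shift {u : ℕ → ℕ} (hu : CantorDigits u) (n : ℕ) :
    CantorDigits fun i => u (i + n) := fun i hi => hu (i + n) (by omega)

theorem CantorDigits.le_two {u : ℕ → ℕ} (hu : CantorDigits u) (i : ℕ) : u (i + 1) ≤ 2 := by
  have := hu (i + 1) (by omega)
  omega

theorem hasSum_two_div_three_pow : HasSum (fun i : ℕ => (2 : ℝ) / 3 ^ (i + 1)) 1 := by
  have h := (hasSum_geometric_of_lt_one (r := (1 / 3 : ℝ)) (by norm_num) (by norm_num)).mul_left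
    (2 / 3)
  convert! h using 1
  · ext i
    rw [pow_succ, one_div, inv_pow]
    field_simp
  · norm_num

theorem digit_div_nonneg (u : ℕ → ℕ) (i : ℕ) : (0 : ℝ) ≤ (u (i + 1) : ℝ) / (3 : ℝ) ^ (i + 1) := by
  positivity

theorem CantorDigits.digit_div_le {u : ℕ → ℕ} (hu : CantorDigits u) (i : ℕ) :
    (u (i + 1) : ℝ) / (3 : ℝ) ^ (i + 1) ≤ 2 / 3 ^ (i + 1) := by
  have : (u (i + 1) : ℝ) ≤ 2 := by exact_mod_cast hu.le_two i
  gcongr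

theorem CantorDigits.summable {u : ℕ → ℕ} (hu : CantorDigits u) :
    Summable fun i : ℕ => (u (i + 1) : ℝ) / (3 : ℝ) ^ (i + 1) :=
  .of_nonneg_of_le (digit_div_nonneg u) hu.digit_div_le hasSum_two_div_three_pow.summable

theorem val_nonneg (u : ℕ → ℕ) : 0 ≤ val 3 u := tsum_nonneg fun i => by positivity

theorem CantorDigits.val_le_one {u : ℕ → ℕ} (hu : CantorDigits u) : val 3 u ≤ 1 := by
  rw [← hasSum_two_div_three_pow.tsum_eq]
  exact hu.summable.tsum_le_tsum hu.digit_div_le hasSum_two_div_three_pow.summable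

theorem CantorDigits.val_eq {u : ℕ → ℕ} (hu : CantorDigits u) :
    val 3 u = (u 1 + val 3 fun i => u (i + 1)) / 3 := by
  have h := hu.summable.tsum_eq_zero_add
  simp only [val, Nat.cast_ofNat] at h ⊢
  rw [h, add_div, ← tsum_div_const]
  congr 1
  · simp
  · congr 1
    ext i
    rw [pow_succ _ (i + 1)]
    field_simp

theorem CantorDigits.val_sub_val_of_agree {u v : ℕ → ℕ} (hu : CantorDigits u)
    (hv : CantorDigits v) (n : ℕ) (h : ∀ i, 1 ≤ i → i ≤ n → u i = v i) :
    val 3 u - val 3 v = ((val 3 fun i => u (i + n)) - val 3 fun i => v (i + n)) / 3 ^ n := by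
  induction n with
  | zero => simp
  | succ n ih =>
    rw [ih fun i h1 h2 => h i h1 (by omega), (hu.shift n).val_eq, (hv.shift n).val_eq,
      show 1 + n = n + 1 by omega, h (n + 1) (by omega) le_rfl]
    simp only [show ∀ i, i + 1 + n = i + (n + 1) from fun i => by omega]
    rw [pow_succ]
    field_simp
    ring

theorem CantorDigits.abs_val_sub_val_le {u v : ℕ → ℕ} (hu : CantorDigits u)
    (hv : CantorDigits v) {n : ℕ} (h : ∀ i, 1 ≤ i → i ≤ n → u i = v i) :
    |val 3 u - val 3 v| ≤ 1 / 3 ^ n := by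
  rw [hu.val_sub_val_of_agree hv n h, abs_div, abs_of_pos (by positivity : (0 : ℝ) < 3 ^ n)]
  gcongr
  have h1 := val_nonneg fun i => u (i + n)
  have h2 := val_nonneg fun i => v (i + n)
  have h3 := (hu.shift n).val_le_one
  have h4 := (hv.shift n).val_le_one
  rw [abs_le]
  constructor <;> linarith

theorem CantorDigits.third_le_abs_val_sub_val {u v : ℕ → ℕ} (hu : CantorDigits u)
    (hv : CantorDigits v) (h : u 1 ≠ v 1) : 1 / 3 ≤ |val 3 u - val 3 v| := by
  have h1 := val_nonneg fun i => u (i + 1)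
  have h2 := val_nonneg fun i => v (i + 1)
  have h3 := (hu.shift 1).val_le_one
  have h4 := (hv.shift 1).val_le_one
  rw [hu.val_eq, hv.val_eq, le_abs]
  rcases hu 1 le_rfl with h5 | h5 <;> rcases hv 1 le_rfl with h6 | h6 <;>
    simp only [h5, h6, ne_eq, not_true_eq_false] at h ⊢
  · right
    push_cast
    linarith
  · left
    push_cast
    linarith

theorem CantorDigits.le_abs_val_sub_val {u v : ℕ → ℕ} (hu : CantorDigits u)
    (hv : CantorDigits v) {n : ℕ} (h : ∃ i, 1 ≤ i ∧ i ≤ n ∧ u i ≠ v i) :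
    1 / 3 ^ n ≤ |val 3 u - val 3 v| := by
  classical
  obtain ⟨hk1, hkn, hk⟩ := Nat.find_spec h
  have hmin : ∀ i, 1 ≤ i → i ≤ Nat.find h - 1 → u i = v i := by
    intro i hi hi'
    by_contra hne
    have := Nat.find_min' h ⟨hi, by omega, hne⟩
    omega
  generalize Nat.find h = k at hk1 hkn hk hmin
  obtain ⟨k, rfl⟩ : ∃ j, k = j + 1 := ⟨k - 1, by omega⟩
  rw [hu.val_sub_val_of_agree hv k hmin, abs_div, abs_of_pos (by positivity : (0 : ℝ) < 3 ^ k)]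
  have h3 := (hu.shift k).third_le_abs_val_sub_val (hv.shift k) (by rwa [add_comm 1 k])
  calc (1 : ℝ) / 3 ^ n ≤ 1 / 3 ^ (k + 1) := by gcongr; norm_num
    _ = 1 / 3 / 3 ^ k := by rw [pow_succ]; field_simp
    _ ≤ _ := by gcongr

theorem CantorDigits.agree_of_abs_lt {u v : ℕ → ℕ} (hu : CantorDigits u)
    (hv : CantorDigits v) {n : ℕ} (h : |val 3 u - val 3 v| < 1 / 3 ^ n) :
    ∀ i, 1 ≤ i → i ≤ n → u i = v i := by
  intro i h1 h2
  by_contra hne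
  exact absurd (hu.le_abs_val_sub_val hv ⟨i, h1, h2, hne⟩) (not_le.2 h)

/-- The point of the plane with ternary digit pairs `d`. -/
def pt (d : ℕ → ℕ × ℕ) : ℝ × ℝ := (val 3 fun i => (d i).1, val 3 fun i => (d i).2)

/-- Both coordinate digit strings have all digits `0` or `2`. -/
def CantorPairs (d : ℕ → ℕ × ℕ) : Prop :=
  CantorDigits (fun i => (d i).1) ∧ CantorDigits fun i => (d i).2

theorem CantorPairs.shift {d : ℕ → ℕ × ℕ} (hd : CantorPairs d) (n : ℕ) :
    CantorPairs fun i => d (i + n) := ⟨hd.1.shift n, hd.2.shift n⟩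

theorem CantorPairs.dist_pt_le {d e : ℕ → ℕ × ℕ} (hd : CantorPairs d) (he : CantorPairs e) {n : ℕ}
    (h : ∀ i, i < n → d (i + 1) = e (i + 1)) : dist (pt d) (pt e) ≤ 1 / 3 ^ n := by
  have h' : ∀ i, 1 ≤ i → i ≤ n → d i = e i := fun i h1 h2 => by
    have := h (i - 1) (by omega)
    rwa [Nat.sub_add_cancel h1] at this
  rw [Prod.dist_eq, max_le_iff, Real.dist_eq, Real.dist_eq]
  exact ⟨hd.1.abs_val_sub_val_le he.1 fun i h1 h2 => by rw [h' i h1 h2],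
    hd.2.abs_val_sub_val_le he.2 fun i h1 h2 => by rw [h' i h1 h2]⟩

theorem CantorPairs.agree_of_dist_lt {d e : ℕ → ℕ × ℕ} (hd : CantorPairs d) (he : CantorPairs e)
    {n : ℕ} (h : dist (pt d) (pt e) < 1 / 3 ^ n) : ∀ i, i < n → d (i + 1) = e (i + 1) := by
  rw [Prod.dist_eq, max_lt_iff, Real.dist_eq, Real.dist_eq] at h
  intro i hi
  exact Prod.ext (hd.1.agree_of_abs_lt he.1 h.1 (i + 1) (by omega) (by omega))
    (hd.2.agree_of_abs_lt he.2 h.2 (i + 1) (by omega) (by omega))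

theorem CantorPairs.agree_of_pt_eq {d e : ℕ → ℕ × ℕ} (hd : CantorPairs d) (he : CantorPairs e)
    (h : pt d = pt e) : ∀ i, 1 ≤ i → d i = e i := by
  intro i hi
  have := hd.agree_of_dist_lt he (n := i) (by rw [h, dist_self]; positivity) (i - 1) (by omega)
  rwa [Nat.sub_add_cancel hi] at this

theorem cantorPairs_of_mem {J : Finset (ℕ × ℕ)}
    (hJ : ∀ e ∈ J, (e.1 = 0 ∨ e.1 = 2) ∧ (e.2 = 0 ∨ e.2 = 2)) {d : ℕ → ℕ × ℕ}
    (hd : ∀ i, 1 ≤ i → d i ∈ J) : CantorPairs d :=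
  ⟨fun i hi => (hJ _ (hd i hi)).1, fun i hi => (hJ _ (hd i hi)).2⟩

theorem rep_pt {J : Finset (ℕ × ℕ)}
    (hJ : ∀ e ∈ J, (e.1 = 0 ∨ e.1 = 2) ∧ (e.2 = 0 ∨ e.2 = 2)) (R : RepMap 3 J) {d : ℕ → ℕ × ℕ}
    (hd : ∀ i, 1 ≤ i → d i ∈ J) : ∀ i, 1 ≤ i → R.rep (pt d) i = d i := by
  have hp : pt d ∈ carpet 3 J := ⟨d, hd, rfl⟩
  exact (cantorPairs_of_mem hJ (R.mem_J _ hp)).agree_of_pt_eq (cantorPairs_of_mem hJ hd)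
    (R.eq_val _ hp).symm

theorem iterate_Tmap_pt {J : Finset (ℕ × ℕ)}
    (hJ : ∀ e ∈ J, (e.1 = 0 ∨ e.1 = 2) ∧ (e.2 = 0 ∨ e.2 = 2)) (R : RepMap 3 J) {d : ℕ → ℕ × ℕ}
    (hd : ∀ i, 1 ≤ i → d i ∈ J) (n : ℕ) : (Tmap R)^[n] (pt d) = pt fun i => d (i + n) := by
  induction n with
  | zero => simp
  | succ n ih =>
    have hdn : ∀ i, 1 ≤ i → d (i + n) ∈ J := fun i hi => hd (i + n) (by omega)
    have hc := cantorPairs_of_mem hJ hdn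
    rw [Function.iterate_succ_apply', ih, Tmap, rep_pt hJ R hdn 1 le_rfl]
    simp only [pt]
    rw [hc.1.val_eq, hc.2.val_eq]
    simp only [show ∀ i, i + 1 + n = i + (n + 1) from fun i => by omega]
    ext <;> push_cast <;> ring

/-- The points whose first `L` ternary digit pairs are given by `τ`. -/
def digitCylinder {L : ℕ} (τ : Fin L → ℕ × ℕ) : Set (ℝ × ℝ) :=
  {p | ∃ d, CantorPairs d ∧ p = pt d ∧ ∀ i : Fin L, d (i + 1) = τ i}

theorem ediam_digitCylinder_le {L : ℕ} (τ : Fin L → ℕ × ℕ) :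
    Metric.ediam (digitCylinder τ) ≤ ENNReal.ofReal (1 / 3 ^ L) := by
  refine Metric.ediam_le ?_
  rintro _ ⟨d, hd, rfl, hdt⟩ _ ⟨e, he, rfl, het⟩
  rw [edist_dist]
  exact ENNReal.ofReal_le_ofReal (hd.dist_pt_le he fun i hi =>
    (hdt ⟨i, hi⟩).trans (het ⟨i, hi⟩).symm)

theorem tsum_ediam_digitCylinder_le (A : ℕ → Finset (ℕ × ℕ)) (L : ℕ) (s : ℝ≥0) :
    ∑' τ : ↥(Fintype.piFinset fun i : Fin L => A i), Metric.ediam (digitCylinder τ.1) ^ (s : ℝ) ≤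
      ENNReal.ofReal ((∏ i ∈ Finset.range L, ((A i).card : ℝ)) * 3 ^ (-(s * L) : ℝ)) := by
  have hpow : ((1 : ℝ) / 3 ^ L) ^ (s : ℝ) = 3 ^ (-(s * L) : ℝ) := by
    rw [one_div, ← Real.rpow_natCast, ← Real.rpow_neg (by norm_num),
      ← Real.rpow_mul (by norm_num), neg_mul, mul_comm]
  calc _ ≤ ∑' _ : ↥(Fintype.piFinset fun i : Fin L => A i),
        ENNReal.ofReal (3 ^ (-(s * L) : ℝ)) := by
        refine ENNReal.tsum_le_tsum fun τ => ?_
        refine (ENNReal.rpow_le_rpow (ediam_digitCylinder_le τ.1) s.coe_nonneg).trans ?_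
        rw [ENNReal.ofReal_rpow_of_nonneg (by positivity) s.coe_nonneg, hpow]
    _ = _ := by
        rw [tsum_fintype, Finset.sum_const, Finset.card_univ, Fintype.card_coe,
          Fintype.card_piFinset, nsmul_eq_mul, ENNReal.ofReal_mul (by positivity),
          Fin.prod_univ_eq_prod_range (fun i => (A i).card) L, ← Nat.cast_prod,
          ENNReal.ofReal_natCast]

theorem dimH_le_of_frequently_mem_cylinder (E : Set (ℝ × ℝ)) (A : ℕ → ℕ → Finset (ℕ × ℕ))
    (L : ℕ → ℕ) (hL : ∀ n, n ≤ L n)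
    (hE : ∀ p ∈ E, ∃ d, CantorPairs d ∧ p = pt d ∧ ∃ᶠ n in atTop, ∀ i < L n, d (i + 1) ∈ A n i)
    (s : ℝ≥0) {c : ℝ} (hc : 0 < c)
    (hcount : ∀ᶠ n : ℕ in atTop, (∏ i ∈ Finset.range (L n), ((A n i).card : ℝ)) *
      (3 : ℝ) ^ (-(s * L n) : ℝ) ≤ (3 : ℝ) ^ (-(c * n))) : dimH E ≤ s := by
  classical
  apply dimH_le_of_hausdorffMeasure_ne_top
  let ι : ℕ → Type := fun N =>
    Σ k : ℕ, ↥(Fintype.piFinset fun i : Fin (L (k + N)) => A (k + N) i)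
  let t : ∀ N, ι N → Set (ℝ × ℝ) := fun N τ => digitCylinder τ.2.1
  have hr : Tendsto (fun N : ℕ => ENNReal.ofReal ((1 / 3) ^ N)) atTop (𝓝 0) := by
    rw [← ENNReal.ofReal_zero]
    exact ENNReal.tendsto_ofReal
      (tendsto_pow_atTop_nhds_zero_of_lt_one (by norm_num) (by norm_num))
  have hle := Measure.hausdorffMeasure_le_liminf_tsum (s : ℝ) E _ hr t (.of_forall fun N τ => by
    refine (ediam_digitCylinder_le τ.2.1).trans (ENNReal.ofReal_le_ofReal ?_)
    rw [← one_div_pow]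
    exact pow_le_pow_of_le_one (by norm_num) (by norm_num)
      ((Nat.le_add_left N τ.1).trans (hL _))) (.of_forall fun N p hp => by
    obtain ⟨d, hd, hpd, hfreq⟩ := hE p hp
    obtain ⟨n, hn, hdn⟩ := hfreq.forall_exists_of_atTop N
    obtain ⟨k, rfl⟩ := Nat.exists_eq_add_of_le' hn
    exact mem_iUnion.2 ⟨⟨k, fun i => d (i + 1), Fintype.mem_piFinset.2 fun i => hdn i i.2⟩,
      d, hd, hpd, fun _ => rfl⟩)
  let g : ℕ → ℝ≥0∞ := fun n => ENNReal.ofReal ((3 : ℝ) ^ (-(c * n)))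
  have hg : ∑' n, g n ≠ ∞ := by
    have hpow : ∀ n : ℕ, (3 : ℝ) ^ (-(c * n)) = ((3 : ℝ) ^ (-c)) ^ n := fun n => by
      rw [← Real.rpow_natCast, ← Real.rpow_mul (by norm_num), neg_mul]
    simp only [g, hpow]
    rw [← ENNReal.ofReal_tsum_of_nonneg (fun n => by positivity)
      (summable_geometric_of_lt_one (by positivity)
        (Real.rpow_lt_one_of_one_lt_of_neg (by norm_num) (by linarith)))]
    exact ENNReal.ofReal_ne_top
  have hsum : ∀ᶠ N in atTop, ∑' τ, Metric.ediam (t N τ) ^ (s : ℝ) ≤ ∑' k, g (k + N) := by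
    obtain ⟨N₀, hN₀⟩ := eventually_atTop.1 hcount
    filter_upwards [eventually_ge_atTop N₀] with N hN
    refine (ENNReal.tsum_sigma' _).trans_le (ENNReal.tsum_le_tsum fun k => ?_)
    exact (tsum_ediam_digitCylinder_le (A (k + N)) (L (k + N)) s).trans
      (ENNReal.ofReal_le_ofReal (hN₀ _ (by omega)))
  have hlim : liminf (fun N => ∑' τ, Metric.ediam (t N τ) ^ (s : ℝ)) atTop = 0 := by
    refine Tendsto.liminf_eq ?_
    exact tendsto_of_tendsto_of_tendsto_of_le_of_le' tendsto_const_nhds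
      (ENNReal.tendsto_sum_nat_add g hg) (.of_forall fun _ => zero_le) hsum
  rw [hlim] at hle
  exact (hle.trans_lt ENNReal.zero_lt_top).ne

theorem le_dimH_of_le_card (A : ℕ → Finset (ℕ × ℕ))
    (hA : ∀ i, ∀ e ∈ A i, (e.1 = 0 ∨ e.1 = 2) ∧ (e.2 = 0 ∨ e.2 = 2))
    (hne : ∀ i, (A i).Nonempty) (E : Set (ℝ × ℝ))
    (hE : ∀ d, (∀ i, d (i + 1) ∈ A i) → pt d ∈ E) (s : ℝ≥0) (hs : 0 < s)
    (hcount : ∀ᶠ m : ℕ in atTop, (3 : ℝ) ^ (s * (m + 2) : ℝ) ≤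
      ∏ i ∈ Finset.range m, ((A i).card : ℝ)) : s ≤ dimH E := by
  classical
  have hne' : ∀ i, Nonempty ↥(A i) := fun i => (hne i).to_subtype
  let ν : ∀ i, Measure ↥(A i) := fun i => (PMF.uniformOfFintype ↥(A i)).toMeasure
  let P : Measure (∀ i, ↥(A i)) := Measure.infinitePi ν
  let D : (∀ i, ↥(A i)) → ℕ → ℕ × ℕ := fun ω i => (ω (i - 1)).1
  let φ : (∀ i, ↥(A i)) → ℝ × ℝ := fun ω => pt (D ω)
  have hD : ∀ ω, CantorPairs (D ω) := fun ω =>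
    ⟨fun i _ => (hA _ _ (ω (i - 1)).2).1, fun i _ => (hA _ _ (ω (i - 1)).2).2⟩
  have hφ : Measurable φ := by
    refine Continuous.measurable (.prodMk ?_ ?_)
    · refine continuous_tsum (fun i => ?_) hasSum_two_div_three_pow.summable fun i ω => ?_
      · have : Continuous fun q : ↥(A i) => (q.1.1 : ℝ) / (3 : ℕ) ^ (i + 1) :=
          continuous_of_discreteTopology
        exact this.comp (continuous_apply i)
      · have := (hD ω).1.digit_div_le i
        rw [Real.norm_of_nonneg (by positivity)]
        exact_mod_cast this
    · refine continuous_tsum (fun i => ?_) hasSum_two_div_three_pow.summable fun i ω => ?_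
      · have : Continuous fun q : ↥(A i) => (q.1.2 : ℝ) / (3 : ℕ) ^ (i + 1) :=
          continuous_of_discreteTopology
        exact this.comp (continuous_apply i)
      · have := (hD ω).2.digit_div_le i
        rw [Real.norm_of_nonneg (by positivity)]
        exact_mod_cast this
  obtain ⟨m₀, hm₀⟩ := eventually_atTop.1 hcount
  have key : ∀ m, m₀ ≤ m → ∀ S : Set (ℝ × ℝ),
      Metric.ediam S ≤ ENNReal.ofReal (1 / 3 ^ (m + 1)) →
      P.map φ S ≤ ENNReal.ofReal ((1 / 3 ^ (m + 2)) ^ (s : ℝ)) := by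
    intro m hm S hS
    have hcl : MeasurableSet (closure S) := isClosed_closure.measurableSet
    refine (measure_mono subset_closure).trans ?_
    rw [Measure.map_apply hφ hcl]
    rcases (φ ⁻¹' closure S).eq_empty_or_nonempty with h0 | ⟨ω₀, hω₀⟩
    · rw [h0, measure_empty]
      exact zero_le
    have hsub : φ ⁻¹' closure S ⊆ Set.pi (Finset.range m) fun i => {ω₀ i} := by
      intro ω hω i hi
      have hdist : dist (pt (D ω)) (pt (D ω₀)) ≤ 1 / 3 ^ (m + 1) := by
        rw [← ENNReal.ofReal_le_ofReal_iff (by positivity), ← edist_dist]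
        refine (Metric.edist_le_ediam_of_mem (s := closure S) hω hω₀).trans ?_
        rwa [Metric.ediam_closure]
      have hlt : dist (pt (D ω)) (pt (D ω₀)) < 1 / 3 ^ m := by
        refine hdist.trans_lt ?_
        rw [pow_succ]
        exact one_div_lt_one_div_of_lt (by positivity) (by linarith [pow_pos (by norm_num : (0:ℝ) < 3) m])
      exact Subtype.ext ((hD ω).agree_of_dist_lt (hD ω₀) hlt i (by simpa using hi))
    refine (measure_mono hsub).trans ?_
    rw [Measure.infinitePi_pi _ fun i _ => measurableSet_singleton _]
    have hν : ∀ i, ν i {ω₀ i} = ENNReal.ofReal ((A i).card : ℝ)⁻¹ := fun i => by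
      simp only [ν]
      rw [PMF.toMeasure_apply_singleton _ _ (measurableSet_singleton _),
        PMF.uniformOfFintype_apply, Fintype.card_coe,
        ENNReal.ofReal_inv_of_pos (by exact_mod_cast (hne i).card_pos), ENNReal.ofReal_natCast]
    rw [Finset.prod_congr rfl fun i _ => hν i,
      ← ENNReal.ofReal_prod_of_nonneg fun i _ => by positivity, Finset.prod_inv_distrib]
    refine ENNReal.ofReal_le_ofReal ?_
    have h3 : ((1 : ℝ) / 3 ^ (m + 2)) ^ (s : ℝ) = ((3 : ℝ) ^ (s * (m + 2) : ℝ))⁻¹ := by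
      rw [one_div, Real.inv_rpow (by positivity), ← Real.rpow_natCast,
        ← Real.rpow_mul (by norm_num), mul_comm]
      push_cast
      rfl
    rw [h3]
    exact inv_anti₀ (by positivity) (hm₀ m hm)
  have hle : P.map φ ≤ Measure.hausdorffMeasure s := by
    refine Measure.le_hausdorffMeasure s _ (ENNReal.ofReal (1 / 3 ^ (m₀ + 1)))
      (by rw [ENNReal.ofReal_pos]; positivity) fun S hS => ?_
    rcases eq_or_ne (Metric.ediam S) 0 with h0 | h0
    · have hlim : Tendsto (fun m : ℕ => ENNReal.ofReal ((1 / 3 ^ (m + 2)) ^ (s : ℝ))) atTop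
          (𝓝 0) := by
        rw [← ENNReal.ofReal_zero, ← Real.zero_rpow (NNReal.coe_ne_zero.2 hs.ne')]
        refine ENNReal.tendsto_ofReal (Tendsto.rpow_const ?_ (.inr s.coe_nonneg))
        have := (tendsto_pow_atTop_nhds_zero_of_lt_one (r := (1 / 3 : ℝ))
          (by norm_num) (by norm_num)).comp (tendsto_add_atTop_nat 2)
        simpa [Function.comp_def] using this
      have : P.map φ S ≤ 0 := ge_of_tendsto hlim
        ((eventually_ge_atTop m₀).mono fun m hm => key m hm S (by rw [h0]; exact zero_le))
      exact this.trans zero_le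
    · have hfin : Metric.ediam S ≠ ∞ := (hS.trans_lt ENNReal.ofReal_lt_top).ne
      have hr0 : 0 < (Metric.ediam S).toReal := ENNReal.toReal_pos h0 hfin
      have hS' : (Metric.ediam S).toReal ≤ 1 / 3 ^ (m₀ + 1) :=
        ENNReal.toReal_le_of_le_ofReal (by positivity) hS
      have hr1 : (Metric.ediam S).toReal ≤ 1 := hS'.trans (by
        rw [← one_div_pow]
        exact pow_le_one₀ (by norm_num) (by norm_num))
      obtain ⟨n, hn1, hn2⟩ := exists_nat_pow_near_of_lt_one hr0 hr1 (y := (1 / 3 : ℝ))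
        (by norm_num) (by norm_num)
      have hn : m₀ + 1 < n + 1 := by
        rw [← one_div_pow] at hS'
        exact (pow_lt_pow_iff_right_of_lt_one₀ (by norm_num) (by norm_num)).1 (hn1.trans_le hS')
      obtain ⟨m, rfl⟩ : ∃ m, n = m + 1 := ⟨n - 1, by omega⟩
      rw [one_div_pow] at hn1 hn2
      refine (key m (by omega) S ?_).trans ?_
      · rw [← ENNReal.ofReal_toReal hfin]
        exact ENNReal.ofReal_le_ofReal hn2
      · rw [← ENNReal.ofReal_toReal hfin, ENNReal.ofReal_rpow_of_nonneg hr0.le s.coe_nonneg]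
        exact ENNReal.ofReal_le_ofReal (Real.rpow_le_rpow (by positivity) hn1.le s.coe_nonneg)
  refine le_dimH_of_hausdorffMeasure_ne_zero (ne_of_gt ?_)
  have huniv : φ ⁻¹' E = univ := eq_univ_of_forall fun ω => hE _ fun i => (ω i).2
  calc (0 : ℝ≥0∞) < P univ := by rw [measure_univ]; exact zero_lt_one
    _ = P (φ ⁻¹' E) := by rw [huniv]
    _ ≤ P.map φ E := Measure.le_map_apply hφ.aemeasurable E
    _ ≤ _ := hle E

theorem prod_range_le_pow (f : ℕ → ℝ) (hf : ∀ i, 0 ≤ f i) {n m k L : ℕ} (hL : L ≤ n + m + k)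
    (h1 : ∀ i < n, f i ≤ 3) (h2 : ∀ i < n + m, n ≤ i → f i ≤ 1) (h3 : ∀ i < L, n + m ≤ i → f i ≤ 2) :
    ∏ i ∈ Finset.range L, f i ≤ 3 ^ n * 2 ^ k := by
  let g : ℕ → ℝ := fun i => if i < n then 3 else if i < n + m then 1 else 2
  have hg : ∀ i, 1 ≤ g i := fun i => by
    simp only [g]
    split_ifs <;> norm_num
  calc ∏ i ∈ Finset.range L, f i ≤ ∏ i ∈ Finset.range L, g i := by
        refine Finset.prod_le_prod (fun i _ => hf i) fun i hi => ?_
        simp only [g]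
        split_ifs with h h'
        · exact h1 i h
        · exact h2 i h' (not_lt.1 h)
        · exact h3 i (Finset.mem_range.1 hi) (not_lt.1 h')
    _ ≤ ∏ i ∈ Finset.range (n + m + k), g i := by
        rw [← Finset.prod_range_mul_prod_Ico g hL]
        exact le_mul_of_one_le_right (Finset.prod_nonneg fun i _ => zero_le_one.trans (hg i))
          (Finset.one_le_prod fun i _ => hg i)
    _ = 3 ^ n * 2 ^ k := by
        have e1 : ∏ i ∈ Finset.range n, g i = 3 ^ n :=
          (Finset.prod_congr rfl fun i hi => if_pos (Finset.mem_range.1 hi)).trans (by simp)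
        have e2 : ∏ i ∈ Finset.range m, g (n + i) = 1 :=
          Finset.prod_eq_one fun i hi => by simp [g, Finset.mem_range.1 hi]
        have e3 : ∏ i ∈ Finset.range k, g (n + m + i) = 2 ^ k :=
          (Finset.prod_congr rfl fun i hi => by simp [g, add_assoc]).trans
            (by simp : ∏ _ ∈ Finset.range k, (2 : ℝ) = 2 ^ k)
        rw [Finset.prod_range_add, Finset.prod_range_add, e1, e2, e3, mul_one]

theorem carpet_eq_image_pt (J : Finset (ℕ × ℕ)) {p : ℝ × ℝ} (hp : p ∈ carpet 3 J) :
    ∃ d, (∀ i, 1 ≤ i → d i ∈ J) ∧ p = pt d := hp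

theorem cantor_digits_of_eq {J : Finset (ℕ × ℕ)}
    (hJ : J = {((0 : ℕ), (0 : ℕ)), (2, 0), (0, 2)}) :
    ∀ e ∈ J, (e.1 = 0 ∨ e.1 = 2) ∧ (e.2 = 0 ∨ e.2 = 2) := by
  subst hJ
  decide

theorem card_J2_le_two {J : Finset (ℕ × ℕ)} (hJ : J = {((0 : ℕ), (0 : ℕ)), (2, 0), (0, 2)})
    {a : ℕ} (ha : a = 0 ∨ a = 2) : (J2 J a).card ≤ 2 := by
  subst hJ
  rcases ha with rfl | rfl <;> decide

theorem card_J2_two {J : Finset (ℕ × ℕ)} (hJ : J = {((0 : ℕ), (0 : ℕ)), (2, 0), (0, 2)}) :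
    (J2 J 2).card = 1 := by
  subst hJ
  decide

theorem dimH_slice_eq_zero {J : Finset (ℕ × ℕ)} (hJ : J = {((0 : ℕ), (0 : ℕ)), (2, 0), (0, 2)})
    {v : ℕ → ℕ} (hv : CantorDigits v) (a L : ℕ → ℕ) (ha : ∀ n, n ≤ a n) (haL : ∀ n, a n ≤ L n)
    (hK : ∀ K : ℝ, ∀ᶠ n in atTop, K * a n ≤ L n)
    (htwo : ∀ n i, a n ≤ i → i < L n → v (i + 1) = 2) :
    dimH (carpet 3 J ∩ {q : ℝ × ℝ | q.2 = val 3 v}) = 0 := by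
  refine le_antisymm (le_of_forall_gt fun t ht => ?_) zero_le
  obtain ⟨s, hs0, hst⟩ := ENNReal.lt_iff_exists_nnreal_btwn.1 ht
  refine lt_of_le_of_lt ?_ hst
  have hs : (0 : ℝ) < s := by exact_mod_cast hs0
  refine dimH_le_of_frequently_mem_cylinder _ (fun _ i => J2 J (v (i + 1))) L
    (fun n => (ha n).trans (haL n)) ?_ s one_pos ?_
  · rintro p ⟨hp, hpv⟩
    obtain ⟨d, hd, rfl⟩ := carpet_eq_image_pt J hp
    have hdc := cantorPairs_of_mem (cantor_digits_of_eq hJ) hd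
    refine ⟨d, hdc, rfl, Frequently.of_forall fun n i _ => ?_⟩
    refine Finset.mem_filter.2 ⟨hd _ (by omega), ?_⟩
    exact hdc.2.agree_of_abs_lt hv (n := i + 1)
      (by rw [show val 3 (fun i => (d i).2) = val 3 v from hpv]; simp) (i + 1) (by omega) le_rfl
  · filter_upwards [hK (2 / s)] with n hn
    have hprod : ∏ i ∈ Finset.range (L n), ((J2 J (v (i + 1))).card : ℝ) ≤ 3 ^ a n * 2 ^ 0 := by
      refine prod_range_le_pow _ (fun i => by positivity) (m := L n - a n)
        (by have := haL n; omega) (fun i _ => ?_) (fun i hi hi' => ?_) fun i hi hi' => ?_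
      · have := card_J2_le_two hJ (hv (i + 1) (by omega))
        exact_mod_cast this.trans (by norm_num)
      · rw [htwo n i hi' (by have := haL n; omega), card_J2_two hJ]
        norm_num
      · have := haL n
        omega
    have h2 : (2 : ℝ) * a n ≤ s * L n := by
      rw [div_mul_eq_mul_div, div_le_iff₀ hs] at hn
      linarith
    have h3 : (n : ℝ) ≤ a n := by exact_mod_cast ha n
    calc _ ≤ (3 : ℝ) ^ a n * 3 ^ (-(s * L n) : ℝ) := by
          rw [pow_zero, mul_one] at hprod
          gcongr
      _ = 3 ^ (a n - s * L n : ℝ) := by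
          rw [← Real.rpow_natCast, ← Real.rpow_add (by norm_num), sub_eq_add_neg]
      _ ≤ _ := Real.rpow_le_rpow_of_exponent_le (by norm_num) (by linarith)

/-- The digits allowed at position `i + 1` for a point which is close to a point with digits `ρ`
after `n` steps, when the first coordinate is controlled for `L` digits. -/
def allowedDigits (J : Finset (ℕ × ℕ)) (ρ : ℕ → ℕ × ℕ) (L n i : ℕ) : Finset (ℕ × ℕ) :=
  if i < n then J else if i < n + L then {ρ (i - n + 1)} else J2 J (ρ (i - n + 1)).2

theorem exists_digits_of_mem_targetSet {J : Finset (ℕ × ℕ)}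
    (hJ : ∀ e ∈ J, (e.1 = 0 ∨ e.1 = 2) ∧ (e.2 = 0 ∨ e.2 = 2)) (R : RepMap 3 J) {lam xi : ℕ → ℕ}
    (hlam_pos : ∀ n, 1 ≤ lam n) (hle : ∀ n, lam n ≤ xi n) {ρ : ℕ → ℕ × ℕ}
    (hρ : ∀ i, 1 ≤ i → ρ i ∈ J) {p : ℝ × ℝ} (hp : p ∈ targetSet R lam xi (pt ρ).1 (pt ρ).2) :
    ∃ d, CantorPairs d ∧ p = pt d ∧ ∃ᶠ n in atTop, ∀ i < n + (xi n - 1),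
      d (i + 1) ∈ allowedDigits J ρ (lam n - 1) n i := by
  obtain ⟨hpJ, hfreq⟩ := hp
  obtain ⟨d, hd, rfl⟩ := carpet_eq_image_pt J hpJ
  have hdc := cantorPairs_of_mem hJ hd
  have hρc := cantorPairs_of_mem hJ hρ
  refine ⟨d, hdc, rfl, hfreq.mono fun n hn i hi => ?_⟩
  have hpow : ∀ m : ℕ, 1 ≤ m → ((3 : ℕ) : ℝ) ^ (-(m : ℤ)) < 1 / 3 ^ (m - 1) := by
    intro m hm
    rw [zpow_neg, zpow_natCast, ← one_div]
    push_cast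
    exact one_div_lt_one_div_of_lt (by positivity)
      (pow_lt_pow_right₀ (by norm_num) (by omega))
  rw [iterate_Tmap_pt hJ R hd, ← Real.closedBall_eq_Icc, ← Real.closedBall_eq_Icc,
    Metric.mem_closedBall, Metric.mem_closedBall, Real.dist_eq, Real.dist_eq] at hn
  have h1 := (hdc.shift n).1.agree_of_abs_lt hρc.1 (hn.1.trans_lt (hpow _ (hlam_pos n)))
  have h2 := (hdc.shift n).2.agree_of_abs_lt hρc.2
    (hn.2.trans_lt (hpow _ ((hlam_pos n).trans (hle n))))
  have hlx := hle n
  have hidx : n ≤ i → i - n + 1 + n = i + 1 := fun h => by omega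
  unfold allowedDigits
  split_ifs with h h'
  · exact hd _ (by omega)
  · have h3 := h1 (i - n + 1) (by omega) (by omega)
    have h4 := h2 (i - n + 1) (by omega) (by omega)
    simp only [hidx (not_lt.1 h)] at h3 h4
    exact Finset.mem_singleton.2 (Prod.ext h3 h4)
  · have h4 := h2 (i - n + 1) (by omega) (by omega)
    simp only [hidx (not_lt.1 h)] at h4
    exact Finset.mem_filter.2 ⟨hd _ (by omega), h4⟩

theorem dimH_targetSet_le {J : Finset (ℕ × ℕ)}
    (hJ : J = {((0 : ℕ), (0 : ℕ)), (2, 0), (0, 2)}) (R : RepMap 3 J) {lam xi : ℕ → ℕ}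
    (hlam_pos : ∀ n, 1 ≤ lam n) (hle : ∀ n, lam n ≤ xi n) {ρ : ℕ → ℕ × ℕ}
    (hρ : ∀ i, 1 ≤ i → ρ i ∈ J) (L k : ℕ → ℕ) (hL : ∀ n, n ≤ L n)
    (hLxi : ∀ n, L n ≤ n + (xi n - 1)) (hk : ∀ n, L n ≤ n + (lam n - 1) + k n) (s : ℝ≥0) {δ : ℝ}
    (hδ : 0 < δ) (hlim : Tendsto (fun n : ℕ =>
      ((n : ℝ) + k n * (Real.log 2 / Real.log 3) - s * L n) / n) atTop (𝓝 (-δ))) :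
    dimH (targetSet R lam xi (pt ρ).1 (pt ρ).2) ≤ s := by
  have hJ' := cantor_digits_of_eq hJ
  refine dimH_le_of_frequently_mem_cylinder _ (fun n => allowedDigits J ρ (lam n - 1) n) L hL
    (fun p hp => ?_) s (half_pos hδ) ?_
  · obtain ⟨d, hd, hpd, hfreq⟩ := exists_digits_of_mem_targetSet hJ' R hlam_pos hle hρ hp
    exact ⟨d, hd, hpd, hfreq.mono fun n hn i hi => hn i (hi.trans_le (hLxi n))⟩
  · filter_upwards [hlim.eventually_lt_const (show -δ < -(δ / 2) by linarith),
      eventually_gt_atTop 0] with n hn hn0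
    have hn0' : (0 : ℝ) < n := by exact_mod_cast hn0
    have hprod : ∏ i ∈ Finset.range (L n), ((allowedDigits J ρ (lam n - 1) n i).card : ℝ) ≤
        3 ^ n * 2 ^ k n := by
      refine prod_range_le_pow _ (fun i => by positivity) (hk n) (fun i hi => ?_)
        (fun i hi hi' => ?_) fun i hi hi' => ?_
      · rw [allowedDigits, if_pos hi, hJ]
        norm_num
      · rw [allowedDigits, if_neg (by omega), if_pos hi]
        simp
      · rw [allowedDigits, if_neg (by omega), if_neg (by omega)]
        exact_mod_cast card_J2_le_two hJ (hJ' _ (hρ _ (by omega))).2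
    have h2 : (2 : ℝ) ^ k n = 3 ^ (k n * (Real.log 2 / Real.log 3) : ℝ) := by
      have : (3 : ℝ) ^ (Real.log 2 / Real.log 3) = 2 :=
        Real.rpow_logb (by norm_num) (by norm_num) (by norm_num)
      rw [mul_comm, Real.rpow_mul (by norm_num), this, Real.rpow_natCast]
    rw [div_lt_iff₀ hn0'] at hn
    calc _ ≤ (3 : ℝ) ^ n * 2 ^ k n * 3 ^ (-(s * L n) : ℝ) := by gcongr
      _ = 3 ^ (n + k n * (Real.log 2 / Real.log 3) - s * L n : ℝ) := by
          rw [h2, ← Real.rpow_natCast, ← Real.rpow_add (by norm_num),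
            ← Real.rpow_add (by norm_num), sub_eq_add_neg]
      _ ≤ _ := Real.rpow_le_rpow_of_exponent_le (by norm_num) (by linarith)

theorem tendsto_natCast_pred_div {f : ℕ → ℕ} (hf : ∀ n, 1 ≤ f n) {c : ℝ}
    (h : Tendsto (fun n : ℕ => (f n : ℝ) / n) atTop (𝓝 c)) :
    Tendsto (fun n : ℕ => ((f n - 1 : ℕ) : ℝ) / n) atTop (𝓝 c) := by
  have := h.sub tendsto_one_div_atTop_nhds_zero_nat
  rw [sub_zero] at this
  refine this.congr fun n => ?_
  rw [Nat.cast_sub (hf n), Nat.cast_one, sub_div]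

theorem min_dim_pos {l x : ℝ} (hl0 : 0 < l) (hlx : l < x) :
    0 < min (1 / (1 + l)) ((1 + (x - l) * (Real.log 2 / Real.log 3)) / (1 + x)) := by
  have h1 : 0 < x - l := sub_pos.2 hlx
  have h2 : 0 < x := hl0.trans hlx
  exact lt_min (by positivity) (by positivity)

theorem dimH_targetSet_le_min {J : Finset (ℕ × ℕ)}
    (hJ : J = {((0 : ℕ), (0 : ℕ)), (2, 0), (0, 2)}) (R : RepMap 3 J) {lam xi : ℕ → ℕ}
    (hlam_pos : ∀ n, 1 ≤ lam n) (hle : ∀ n, lam n ≤ xi n) {ρ : ℕ → ℕ × ℕ}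
    (hρ : ∀ i, 1 ≤ i → ρ i ∈ J) {l x : ℝ}
    (hl : Tendsto (fun n : ℕ => (lam n : ℝ) / n) atTop (𝓝 l))
    (hx : Tendsto (fun n : ℕ => (xi n : ℝ) / n) atTop (𝓝 x)) (hl0 : 0 < l) (hlx : l < x) :
    dimH (targetSet R lam xi (pt ρ).1 (pt ρ).2) ≤ ENNReal.ofReal (min (1 / (1 + l))
      ((1 + (x - l) * (Real.log 2 / Real.log 3)) / (1 + x))) := by
  have hxi_pos := fun n => (hlam_pos n).trans (hle n)
  have hl' := tendsto_natCast_pred_div hlam_pos hl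
  have hx' := tendsto_natCast_pred_div hxi_pos hx
  refine le_of_forall_gt fun t ht => ?_
  obtain ⟨s, hs, hst⟩ := ENNReal.lt_iff_exists_nnreal_btwn.1 ht
  refine lt_of_le_of_lt ?_ hst
  have hs' : min (1 / (1 + l)) ((1 + (x - l) * (Real.log 2 / Real.log 3)) / (1 + x)) < (s : ℝ) :=
    (ENNReal.ofReal_lt_coe_iff (min_dim_pos hl0 hlx).le).1 hs
  have hne : ∀ᶠ n : ℕ in atTop, (n : ℝ) ≠ 0 :=
    (eventually_gt_atTop 0).mono fun n hn => by positivity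
  rcases min_lt_iff.1 hs' with h | h
  · rw [div_lt_iff₀ (by linarith)] at h
    refine dimH_targetSet_le hJ R hlam_pos hle hρ (fun n => n + (lam n - 1)) (fun _ => 0)
      (fun n => by omega) (fun n => by have := hle n; omega) (fun n => by omega) s
      (sub_pos.2 h) ?_
    have := (tendsto_const_nhds (x := (1 : ℝ))).sub
      ((hl'.const_add 1).const_mul (s : ℝ))
    rw [neg_sub]
    refine this.congr' (hne.mono fun n hn => ?_)
    push_cast
    field_simp
    ring
  · rw [div_lt_iff₀ (by linarith)] at h
    refine dimH_targetSet_le hJ R hlam_pos hle hρ (fun n => n + (xi n - 1))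
      (fun n => xi n - lam n) (fun n => by omega) (fun n => by omega)
      (fun n => by have := hle n; have := hlam_pos n; omega) s (sub_pos.2 h) ?_
    have := ((tendsto_const_nhds (x := (1 : ℝ))).add
      ((hx.sub hl).mul_const (Real.log 2 / Real.log 3))).sub ((hx'.const_add 1).const_mul (s : ℝ))
    rw [neg_sub]
    refine this.congr' (hne.mono fun n hn => ?_)
    simp only [Nat.cast_sub (hle n)]
    push_cast
    field_simp

theorem exists_digit_sets {J : Finset (ℕ × ℕ)}
    (hJ : J = {((0 : ℕ), (0 : ℕ)), (2, 0), (0, 2)}) {lam xi : ℕ → ℕ} (hle : ∀ n, lam n ≤ xi n)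
    {ρ : ℕ → ℕ × ℕ} (hρ : ∀ i, 1 ≤ i → ρ i ∈ J) {N : ℕ → ℕ} (hN : ∀ k, N k + xi (N k) ≤ N (k + 1)) :
    ∃ A : ℕ → Finset (ℕ × ℕ), (∀ i, A i ⊆ J) ∧ (∀ i, (A i).Nonempty) ∧
      (∀ i < N 0, (A i).card = 3) ∧
      (∀ k i, N k + xi (N k) ≤ i → i < N (k + 1) → (A i).card = 3) ∧
      (∀ k i, N k + lam (N k) ≤ i → i < N k + xi (N k) → 2 ≤ (A i).card) ∧
      (∀ k i, N k ≤ i → i < N k + lam (N k) → ∀ e ∈ A i, e = ρ (i - N k + 1)) ∧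
      ∀ k i, N k + lam (N k) ≤ i → i < N k + xi (N k) → ∀ e ∈ A i, e.2 = 0 := by
  classical
  have hmono : Monotone N := monotone_nat_of_le_succ fun k => by have := hN k; omega
  have hlt : ∀ {j k i}, N j ≤ i → i < N k + xi (N k) → j ≤ k := by
    intro j k i h1 h2
    by_contra! h
    have := hmono (Nat.succ_le_of_lt h)
    have := hN k
    simp only [Nat.succ_eq_add_one] at *
    omega
  let A : ℕ → Finset (ℕ × ℕ) := fun i => J.filter fun e =>
    (∀ k, N k ≤ i → i < N k + lam (N k) → e = ρ (i - N k + 1)) ∧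
    ∀ k, N k + lam (N k) ≤ i → i < N k + xi (N k) → e.2 = 0
  have hcard : J.card = 3 := by rw [hJ]; decide
  have hfree : ∀ i, (∀ k, N k ≤ i → N k + xi (N k) ≤ i) → (A i).card = 3 := by
    intro i hi
    rw [← hcard]
    congr 1
    refine Finset.filter_true_of_mem fun e _ => ⟨fun k h1 h2 => ?_, fun k h1 h2 => ?_⟩
    · have := hi k h1
      have := hle (N k)
      omega
    · have := hi k (by omega)
      omega
  have hmem : ∀ i (e : ℕ × ℕ), e ∈ J → e.2 = 0 → (∀ k, N k ≤ i → N k + lam (N k) ≤ i) →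
      e ∈ A i := fun i e he he0 hi => Finset.mem_filter.2 ⟨he, fun k h1 h2 => by
    have := hi k h1
    omega, fun _ _ _ => he0⟩
  refine ⟨A, fun i => Finset.filter_subset _ _, fun i => ?_, fun i hi => hfree i fun k hk => ?_,
    fun k i h1 h2 => hfree i fun j hj => ?_, fun k i h1 h2 => ?_,
    fun k i h1 h2 e he => (Finset.mem_filter.1 he).2.1 k h1 h2,
    fun k i h1 h2 e he => (Finset.mem_filter.1 he).2.2 k h1 h2⟩
  · by_cases h : ∃ k, N k ≤ i ∧ i < N k + lam (N k)
    · obtain ⟨k, h1, h2⟩ := h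
      have hk := hle (N k)
      have huniq : ∀ j, N j ≤ i → i < N j + xi (N j) → j = k := fun j h3 h4 =>
        le_antisymm (hlt h3 (by omega)) (hlt h1 h4)
      refine ⟨ρ (i - N k + 1), Finset.mem_filter.2 ⟨hρ _ (by omega), fun j h3 h4 => ?_,
        fun j h3 h4 => ?_⟩⟩
      · rw [huniq j h3 (by have := hle (N j); omega)]
      · rw [huniq j (by omega) h4] at h3
        omega
    · push Not at h
      exact ⟨(0, 0), hmem i _ (by simp [hJ]) rfl h⟩
  · have := hmono (Nat.zero_le k)
    omega
  · by_contra! h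
    have h3 := hmono (hlt (by omega) h : k ≤ j)
    rcases (hlt (by omega) h : k ≤ j).eq_or_lt with rfl | h4
    · omega
    · have := hmono (Nat.succ_le_of_lt h4)
      simp only [Nat.succ_eq_add_one] at this
      omega
  · have hsub : ({(0, 0), (2, 0)} : Finset (ℕ × ℕ)) ⊆ A i := by
      have hi : ∀ j, N j ≤ i → N j + lam (N j) ≤ i := fun j hj => by
        rcases (hlt hj h2).eq_or_lt with rfl | h4
        · exact h1
        · have := hmono (Nat.succ_le_of_lt h4)
          have := hN j
          have := hle (N j)
          simp only [Nat.succ_eq_add_one] at *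
          omega
      intro e he
      rw [Finset.mem_insert, Finset.mem_singleton] at he
      rcases he with rfl | rfl
      · exact hmem i _ (by simp [hJ]) rfl hi
      · exact hmem i _ (by simp [hJ]) rfl hi
    exact (Finset.card_le_card hsub).trans' (by decide)

theorem sum_range_add_mul_le {g : ℕ → ℝ} {c : ℝ} {a b : ℕ} (hab : a ≤ b)
    (h : ∀ i, a ≤ i → i < b → c ≤ g i) :
    ∑ i ∈ Finset.range a, g i + c * (b - a) ≤ ∑ i ∈ Finset.range b, g i := by
  rw [← Finset.sum_range_add_sum_Ico g hab]
  have := Finset.card_nsmul_le_sum (Finset.Ico a b) g c fun i hi =>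
    h i (Finset.mem_Ico.1 hi).1 (Finset.mem_Ico.1 hi).2
  rw [Nat.card_Ico, nsmul_eq_mul, Nat.cast_sub hab] at this
  linarith

theorem mul_le_sum_of_block {g : ℕ → ℝ} (hg : ∀ i, 0 ≤ g i) {θ s E : ℝ} (hs1 : s ≤ 1) (hs0 : 0 ≤ s)
    {n p q r : ℕ} (hnp : n ≤ p) (hpq : p ≤ q)
    (hn : n - E ≤ ∑ i ∈ Finset.range n, g i)
    (hθ : ∀ i, p ≤ i → i < q → θ ≤ g i) (h1 : ∀ i, q ≤ i → i < r → 1 ≤ g i)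
    (hEp : s * (p + 2) ≤ n - E) (hEq : s * (q + 2) ≤ n - E + (q - p) * θ)
    {m : ℕ} (hnm : n ≤ m) (hmr : m ≤ r) : s * (m + 2) ≤ ∑ i ∈ Finset.range m, g i := by
  rcases le_total m p with hmp | hmp
  · have h2 := sum_range_add_mul_le hnm fun i _ _ => hg i
    have h3 : (m : ℝ) ≤ p := by exact_mod_cast hmp
    nlinarith
  have h2 := sum_range_add_mul_le hnp fun i _ _ => hg i
  rcases le_total m q with hmq | hmq
  · have h3 := sum_range_add_mul_le hmp fun i h4 h5 => hθ i h4 (h5.trans_le hmq)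
    have h4 : (p : ℝ) ≤ m := by exact_mod_cast hmp
    have h5 : (m : ℝ) ≤ q := by exact_mod_cast hmq
    rcases le_total s θ with h6 | h6 <;> nlinarith
  · have h3 := sum_range_add_mul_le hpq hθ
    have h4 := sum_range_add_mul_le hmq fun i h4 h5 => h1 i h4 (h5.trans_le hmr)
    have h5 : (q : ℝ) ≤ m := by exact_mod_cast hmq
    nlinarith

theorem pt_mem_targetSet {J : Finset (ℕ × ℕ)}
    (hJ : ∀ e ∈ J, (e.1 = 0 ∨ e.1 = 2) ∧ (e.2 = 0 ∨ e.2 = 2)) (R : RepMap 3 J) {lam xi : ℕ → ℕ}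
    {ρ : ℕ → ℕ × ℕ} (hρ : ∀ i, 1 ≤ i → ρ i ∈ J) {d : ℕ → ℕ × ℕ} (hd : ∀ i, 1 ≤ i → d i ∈ J)
    (h : ∃ᶠ n in atTop, (∀ i, 1 ≤ i → i ≤ lam n → d (i + n) = ρ i) ∧
      ∀ i, 1 ≤ i → i ≤ xi n → (d (i + n)).2 = (ρ i).2) :
    pt d ∈ targetSet R lam xi (pt ρ).1 (pt ρ).2 := by
  have hdc := cantorPairs_of_mem hJ hd
  have hρc := cantorPairs_of_mem hJ hρ
  refine ⟨⟨d, hd, rfl⟩, h.mono fun n hn => ?_⟩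
  have hpow : ∀ m : ℕ, ((3 : ℕ) : ℝ) ^ (-(m : ℤ)) = 1 / 3 ^ m := fun m => by
    rw [zpow_neg, zpow_natCast, ← one_div]
    push_cast
    rfl
  rw [iterate_Tmap_pt hJ R hd, ← Real.closedBall_eq_Icc, ← Real.closedBall_eq_Icc,
    Metric.mem_closedBall, Metric.mem_closedBall, Real.dist_eq, Real.dist_eq, hpow, hpow]
  exact ⟨(hdc.shift n).1.abs_val_sub_val_le hρc.1 fun i h1 h2 =>
      congrArg Prod.fst (hn.1 i h1 h2),
    (hdc.shift n).2.abs_val_sub_val_le hρc.2 hn.2⟩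

theorem exists_fast_seq {P : ℕ → Prop} (hP : ∀ M, ∃ n, M ≤ n ∧ P n) (F : ℕ → ℕ) (M : ℕ) :
    ∃ N : ℕ → ℕ, (∀ k, P (N k)) ∧ M ≤ N 0 ∧ ∀ k, F (N k) ≤ N (k + 1) := by
  choose g hg hPg using hP
  refine ⟨fun k => Nat.rec (g M) (fun _ n => g (F n)) k, fun k => ?_, hg M, fun k => hg _⟩
  cases k <;> exact hPg _

theorem le_dimH_targetSet_of_eventually {J : Finset (ℕ × ℕ)}
    (hJ : J = {((0 : ℕ), (0 : ℕ)), (2, 0), (0, 2)}) (R : RepMap 3 J) {lam xi : ℕ → ℕ}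
    (hle : ∀ n, lam n ≤ xi n) {ρ : ℕ → ℕ × ℕ} (hρ : ∀ i, 1 ≤ i → ρ i ∈ J)
    (hgood : ∀ M, ∃ n, M ≤ n ∧ ∀ i, lam n ≤ i → i < xi n → (ρ (i + 1)).2 = 0)
    {s : ℝ≥0} (hs0 : 0 < s) (hs1 : s ≤ 1) {η : ℝ} (hη : 0 < η)
    (hlam : ∀ᶠ n : ℕ in atTop, s * (n + lam n + 2) ≤ n - η * n)
    (hxi : ∀ᶠ n : ℕ in atTop,
      s * (n + xi n + 2) ≤ n - η * n + (xi n - lam n) * (Real.log 2 / Real.log 3)) :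
    s ≤ dimH (targetSet R lam xi (pt ρ).1 (pt ρ).2) := by
  obtain ⟨M, hM⟩ := eventually_atTop.1 (hlam.and hxi)
  obtain ⟨K, hK⟩ := exists_nat_ge (1 / η)
  obtain ⟨N, hNgood, hN0, hNF⟩ := exists_fast_seq hgood
    (fun n => (K + 1) * (n + xi n) + n + 1) M
  have hN : ∀ k, N k + xi (N k) ≤ N (k + 1) := fun k => by
    have := hNF k
    nlinarith
  have hNlt : StrictMono N := strictMono_nat_of_lt_succ fun k => by
    have := hNF k
    have := Nat.zero_le ((K + 1) * (N k + xi (N k)))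
    omega
  have hNE : ∀ k, ((N k + xi (N k) : ℕ) : ℝ) ≤ η * N (k + 1) := fun k => by
    have h1 : K * (N k + xi (N k)) ≤ N (k + 1) := by
      have := hNF k
      nlinarith
    have h2 : (K : ℝ) * ((N k + xi (N k) : ℕ) : ℝ) ≤ N (k + 1) := by exact_mod_cast h1
    rw [div_le_iff₀ hη] at hK
    have h3 : (0 : ℝ) ≤ ((N k + xi (N k) : ℕ) : ℝ) := by positivity
    nlinarith
  obtain ⟨A, hAJ, hAne, hA0, hA1, hA2, hAρ, hAz⟩ := exists_digit_sets hJ hle hρ hN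
  have hJ' : ∀ e ∈ J, (e.1 = 0 ∨ e.1 = 2) ∧ (e.2 = 0 ∨ e.2 = 2) := by rw [hJ]; decide
  set g : ℕ → ℝ := fun i => Real.logb 3 (A i).card with hgdef
  have hcard : ∀ i, (0 : ℝ) < (A i).card := fun i => by exact_mod_cast (hAne i).card_pos
  have hg : ∀ i, 0 ≤ g i := fun i =>
    Real.logb_nonneg (by norm_num) (by exact_mod_cast (hAne i).card_pos)
  have hg1 : ∀ i, (A i).card = 3 → 1 ≤ g i := fun i hi => by
    simp only [hgdef, hi]
    norm_num
  have hg2 : ∀ i, 2 ≤ (A i).card → Real.log 2 / Real.log 3 ≤ g i := fun i hi =>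
    Real.logb_le_logb_of_le (by norm_num) (by norm_num) (by exact_mod_cast hi)
  have hgprod : ∀ m, ∏ i ∈ Finset.range m, ((A i).card : ℝ)
      = (3 : ℝ) ^ (∑ i ∈ Finset.range m, g i) := fun m => by
    rw [Real.rpow_sum_of_pos (by norm_num)]
    exact Finset.prod_congr rfl fun i _ =>
      (Real.rpow_logb (by norm_num) (by norm_num) (hcard i)).symm
  have hS : ∀ k, N k - η * N k ≤ ∑ i ∈ Finset.range (N k), g i := by
    rintro (_ | k)
    · have := sum_range_add_mul_le (g := g) (Nat.zero_le (N 0)) fun i _ hi => hg1 i (hA0 i hi)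
      simp only [Finset.range_zero, Finset.sum_empty, Nat.cast_zero] at this
      have h2 : 0 ≤ η * N 0 := by positivity
      linarith
    · have := sum_range_add_mul_le (g := g) (hN k) fun i h1 h2 => hg1 i (hA1 k i h1 h2)
      have h2 := hNE k
      have h3 : 0 ≤ ∑ i ∈ Finset.range (N k + xi (N k)), g i := Finset.sum_nonneg fun i _ => hg i
      linarith
  refine le_dimH_of_le_card A (fun i e he => hJ' e (hAJ i he)) hAne _ (fun d hd => ?_) s hs0 ?_
  · refine pt_mem_targetSet hJ' R hρ (fun i hi => ?_) ?_
    · obtain ⟨i, rfl⟩ := Nat.exists_eq_succ_of_ne_zero (Nat.one_le_iff_ne_zero.1 hi)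
      exact hAJ i (hd i)
    · have hforced : ∀ k i, i < lam (N k) → d (i + 1 + N k) = ρ (i + 1) := fun k i hi => by
        have := hAρ k (i + N k) (by omega) (by omega) _ (hd _)
        rwa [Nat.add_sub_cancel, add_right_comm] at this
      refine frequently_atTop.2 fun m => ⟨N m, hNlt.le_apply, fun i h1 h2 => ?_, fun i h1 h2 => ?_⟩
      · obtain ⟨i, rfl⟩ := Nat.exists_eq_succ_of_ne_zero (Nat.one_le_iff_ne_zero.1 h1)
        exact hforced m i h2
      · obtain ⟨i, rfl⟩ := Nat.exists_eq_succ_of_ne_zero (Nat.one_le_iff_ne_zero.1 h1)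
        rcases lt_or_ge i (lam (N m)) with h3 | h3
        · exact congrArg Prod.snd (hforced m i h3)
        · have h4 := hAz m (i + N m) (by omega) (by omega) _ (hd _)
          rw [add_right_comm] at h4
          exact h4.trans (hNgood m i h3 h2).symm
  · filter_upwards [eventually_gt_atTop (N 0)] with m hm
    rw [hgprod]
    refine Real.rpow_le_rpow_of_exponent_le (by norm_num) ?_
    obtain ⟨k, hk1, hk2⟩ := hNlt.exists_between_of_tendsto_atTop hNlt.tendsto_atTop hm
    have hMk := hM (N k) (hN0.trans (hNlt.monotone (Nat.zero_le k)))
    refine mul_le_sum_of_block (p := N k + lam (N k)) (q := N k + xi (N k)) hg hs1 s.2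
      (Nat.le_add_right _ _) (by have := hle (N k); omega) (hS k)
      (fun i h1 h2 => hg2 i (hA2 k i h1 h2)) (fun i h1 h2 => hg1 i (hA1 k i h1 h2)) ?_ ?_
      hk1.le hk2
    · push_cast
      exact hMk.1
    · push_cast
      rw [add_sub_add_left_eq_sub]
      exact hMk.2

theorem ofReal_min_le_dimH_targetSet {J : Finset (ℕ × ℕ)}
    (hJ : J = {((0 : ℕ), (0 : ℕ)), (2, 0), (0, 2)}) (R : RepMap 3 J) {lam xi : ℕ → ℕ}
    (hle : ∀ n, lam n ≤ xi n) {ρ : ℕ → ℕ × ℕ} (hρ : ∀ i, 1 ≤ i → ρ i ∈ J)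
    (hgood : ∀ M, ∃ n, M ≤ n ∧ ∀ i, lam n ≤ i → i < xi n → (ρ (i + 1)).2 = 0) {l x : ℝ}
    (hl : Tendsto (fun n : ℕ => (lam n : ℝ) / n) atTop (𝓝 l))
    (hx : Tendsto (fun n : ℕ => (xi n : ℝ) / n) atTop (𝓝 x)) (hl0 : 0 < l) (hlx : l < x) :
    ENNReal.ofReal (min (1 / (1 + l)) ((1 + (x - l) * (Real.log 2 / Real.log 3)) / (1 + x)))
      ≤ dimH (targetSet R lam xi (pt ρ).1 (pt ρ).2) := by
  refine le_of_forall_lt fun t ht => ?_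
  obtain ⟨s, hts, hs⟩ := ENNReal.lt_iff_exists_nnreal_btwn.1 ht
  refine lt_of_lt_of_le hts ?_
  have hs0 : 0 < s := ENNReal.coe_pos.1 (bot_le.trans_lt hts)
  have hs' : (s : ℝ) < min (1 / (1 + l))
      ((1 + (x - l) * (Real.log 2 / Real.log 3)) / (1 + x)) := by
    rw [← ENNReal.ofReal_coe_nnreal] at hs
    exact (ENNReal.ofReal_lt_ofReal_iff (min_dim_pos hl0 hlx)).1 hs
  obtain ⟨h1, h2⟩ := lt_min_iff.1 hs'
  rw [lt_div_iff₀ (by linarith)] at h1 h2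
  have hs1 : s ≤ 1 := by
    have : (s : ℝ) ≤ 1 := by
      have := s.coe_nonneg
      nlinarith
    exact_mod_cast this
  obtain ⟨η, hη, hη'⟩ := exists_between (lt_min (sub_pos.2 h1) (sub_pos.2 h2))
  obtain ⟨h3, h4⟩ := lt_min_iff.1 hη'
  have hinv : Tendsto (fun n : ℕ => (2 : ℝ) / n) atTop (𝓝 0) := tendsto_const_div_atTop_nhds_zero_nat 2
  refine le_dimH_targetSet_of_eventually hJ R hle hρ hgood hs0 hs1 hη ?_ ?_
  · have hlim := ((hl.const_add 1).add hinv).const_mul (s : ℝ)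
    filter_upwards [hlim.eventually_lt_const (by linarith : (s : ℝ) * (1 + l + 0) < 1 - η),
      eventually_gt_atTop 0] with n hn hn0
    have hn0' : (0 : ℝ) < n := by exact_mod_cast hn0
    have := mul_le_mul_of_nonneg_right hn.le hn0'.le
    field_simp at this
    linarith
  · have hlim := (((hx.const_add 1).add hinv).const_mul (s : ℝ)).sub
      ((hx.sub hl).mul_const (Real.log 2 / Real.log 3))
    filter_upwards [hlim.eventually_lt_const (by linarith :
      (s : ℝ) * (1 + x + 0) - (x - l) * (Real.log 2 / Real.log 3) < 1 - η),
      eventually_gt_atTop 0] with n hn hn0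
    have hn0' : (0 : ℝ) < n := by exact_mod_cast hn0
    have h5 := mul_le_mul_of_nonneg_right hn.le hn0'.le
    have h6 : ((s : ℝ) * (1 + xi n / n + 2 / n) -
        (xi n / n - lam n / n) * (Real.log 2 / Real.log 3)) * n
        = s * (n + xi n + 2) - (xi n - lam n) * (Real.log 2 / Real.log 3) := by
      field_simp
    rw [h6] at h5
    linarith

theorem exists_shift_window {nseq lam xi : ℕ → ℕ}
    (hid : ∀ j, 1 ≤ j → j ≤ nseq j)
    (hratio : Tendsto (fun j : ℕ => (nseq (j + 1) : ℝ) / (nseq j : ℝ)) atTop atTop) {l x : ℝ}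
    (hl : Tendsto (fun n : ℕ => (lam n : ℝ) / n) atTop (𝓝 l))
    (hx : Tendsto (fun n : ℕ => (xi n : ℝ) / n) atTop (𝓝 x)) (hl0 : 0 < l) (M : ℕ) :
    ∃ n j, M ≤ n ∧ Odd j ∧ nseq j ≤ lam n ∧ xi n < nseq (j + 1) := by
  obtain ⟨C, hC⟩ := exists_nat_ge (2 / l)
  have hCpos : (0 : ℝ) < C := (div_pos two_pos hl0).trans_le hC
  rw [div_le_iff₀ hl0] at hC
  obtain ⟨M₁, hM₁⟩ := eventually_atTop.1 ((hl.eventually_const_lt (half_lt_self hl0)).and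
    (hx.eventually_lt_const (lt_add_one x)))
  obtain ⟨M₂, hM₂⟩ := eventually_atTop.1 (hratio.eventually_ge_atTop ((x + 1) * C))
  set j := 2 * (M + M₁ + M₂) + 1
  have hj : j ≤ nseq j := hid j (by omega)
  have hnn : nseq j ≤ C * nseq j := Nat.le_mul_of_pos_left _ (by exact_mod_cast hCpos)
  obtain ⟨h1, h2⟩ := hM₁ (C * nseq j) (by omega)
  have hpos : (0 : ℝ) < nseq j := by exact_mod_cast (by omega : 0 < nseq j)
  have h3 := hM₂ j (by omega)
  rw [le_div_iff₀ hpos] at h3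
  push_cast at h1 h2
  rw [lt_div_iff₀ (by positivity)] at h1
  rw [div_lt_iff₀ (by positivity)] at h2
  refine ⟨C * nseq j, j, by omega, ⟨_, rfl⟩, ?_, ?_⟩
  · have : (nseq j : ℝ) ≤ lam (C * nseq j) := by nlinarith
    exact_mod_cast this
  · have : (xi (C * nseq j) : ℝ) < nseq (j + 1) := by linarith
    exact_mod_cast this

theorem stmt_17
    (J : Finset (ℕ × ℕ)) (hJdef : J = {((0 : ℕ), (0 : ℕ)), (2, 0), (0, 2)})
    (R : RepMap 3 J) (lam xi : ℕ → ℕ)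
    (hlam_pos : ∀ n, 1 ≤ lam n) (hle : ∀ n, lam n ≤ xi n)
    (hlam_top : Tendsto lam atTop atTop)
    (nseq : ℕ → ℕ) (hn1 : nseq 1 = 1)
    (hmono : ∀ j, 1 ≤ j → nseq j < nseq (j + 1))
    (hratio : Tendsto (fun j : ℕ => (nseq (j + 1) : ℝ) / (nseq j : ℝ)) atTop atTop)
    (z w : ℝ) (hzw : (z, w) ∈ carpet 3 J)
    (hdig : ∀ j, 1 ≤ j → ∀ i, nseq j ≤ i → i < nseq (j + 1) →
      R.rep (z, w) i = if Odd j then ((0 : ℕ), (0 : ℕ)) else (0, 2))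
    (l x : ℝ)
    (hl : Tendsto (fun n : ℕ => (lam n : ℝ) / n) atTop (𝓝 l))
    (hx : Tendsto (fun n : ℕ => (xi n : ℝ) / n) atTop (𝓝 x))
    (hl0 : 0 < l) (hlx : l < x) :
    dimH (carpet 3 J ∩ {q : ℝ × ℝ | q.2 = w}) = 0 ∧
    dimH (targetSet R lam xi z w) =
      ENNReal.ofReal (min (1 / (1 + l))
        ((1 + (x - l) * (Real.log 2 / Real.log 3)) / (1 + x))) ∧
    ENNReal.ofReal (1 / (1 + x)) < dimH (targetSet R lam xi z w) := by
  have hJ' : ∀ e ∈ J, (e.1 = 0 ∨ e.1 = 2) ∧ (e.2 = 0 ∨ e.2 = 2) := by rw [hJdef]; decide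
  have hρ := R.mem_J _ hzw
  have hpt : (z, w) = pt (R.rep (z, w)) := R.eq_val _ hzw
  generalize R.rep (z, w) = ρ at hdig hρ hpt
  obtain rfl : z = (pt ρ).1 := congrArg Prod.fst hpt
  obtain rfl : w = (pt ρ).2 := congrArg Prod.snd hpt
  have hid : ∀ j, 1 ≤ j → j ≤ nseq j := fun j hj => by
    induction j, hj using Nat.le_induction with
    | base => exact hn1.ge
    | succ j hj ih => exact Nat.succ_le_of_lt (ih.trans_lt (hmono j hj))
  have hgood : ∀ M, ∃ n, M ≤ n ∧ ∀ i, lam n ≤ i → i < xi n → (ρ (i + 1)).2 = 0 := fun M => by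
    obtain ⟨n, j, hMn, hj, h1, h2⟩ := exists_shift_window hid hratio hl hx hl0 M
    refine ⟨n, hMn, fun i h3 h4 => ?_⟩
    rw [hdig j hj.pos (i + 1) (by omega) (by omega), if_pos hj]
  have hdim := le_antisymm (dimH_targetSet_le_min hJdef R hlam_pos hle hρ hl hx hl0 hlx)
    (ofReal_min_le_dimH_targetSet hJdef R hle hρ hgood hl hx hl0 hlx)
  refine ⟨?_, hdim, ?_⟩
  · refine dimH_slice_eq_zero hJdef (cantorPairs_of_mem hJ' hρ).2 (fun n => nseq (2 * n + 2) - 1)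
      (fun n => nseq (2 * n + 2 + 1) - 1) (fun n => ?_) (fun n => ?_) (fun K => ?_) fun n i h1 h2 => ?_
    · have := hid (2 * n + 2) (by omega)
      omega
    · have := hmono (2 * n + 2) (by omega)
      omega
    · have htop : Tendsto (fun n : ℕ => 2 * n + 2) atTop atTop :=
        tendsto_atTop_mono (fun n => (by omega : n ≤ 2 * n + 2)) tendsto_id
      filter_upwards [(hratio.comp htop).eventually_ge_atTop (max K 1)] with n hn
      have hpos : 1 ≤ nseq (2 * n + 2) := le_trans (by omega) (hid (2 * n + 2) (by omega))
      have hlt := hmono (2 * n + 2) (by omega)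
      have hpos' : (1 : ℝ) ≤ nseq (2 * n + 2) := by exact_mod_cast hpos
      simp only [Function.comp_apply] at hn
      rw [le_div_iff₀ (by linarith)] at hn
      rw [Nat.cast_sub hpos, Nat.cast_sub (hpos.trans hlt.le)]
      have h1 := le_max_left K 1
      have h2 := le_max_right K 1
      push_cast
      nlinarith
    · have h0 := hid (2 * n + 2) (by omega)
      rw [hdig (2 * n + 2) (by omega) (i + 1) (by omega) (by omega),
        if_neg (by simp [parity_simps])]
  · rw [hdim, ENNReal.ofReal_lt_ofReal_iff (min_dim_pos hl0 hlx)]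
    have hθ : 0 < (x - l) * (Real.log 2 / Real.log 3) :=
      mul_pos (sub_pos.2 hlx) (div_pos (Real.log_pos (by norm_num)) (Real.log_pos (by norm_num)))
    exact lt_min (one_div_lt_one_div_of_lt (by linarith) (by linarith))
      (div_lt_div_of_pos_right (by linarith) (by linarith))

end ShrinkingRect
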